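/- Let X := ℙ^{n_1} × ⋯ × ℙ^{n_k}. Fix i ∈ {1,…,k}, s ∈ ℕ, and (a_1,…,a_k) ∈ ℕ^k with a_i ≥ t(n_i) − 1, where t(n_i) is an integer such that for all t ≥ t(n_i) and all cardinalities, a general finite subset A of ℙ^{n_i} satisfies h^0(I_A ⊗ Ω^1_{ℙ^{n_i}}(t)) = 0 or h^1(I_A ⊗ Ω^1_{ℙ^{n_i}}(t)) = 0. Let S ⊂ X be a general subset of cardinality s. Set τ_1 := ⌊h^0(Ω^1_{ℙ^{n_i}}(a_i+1))/n_i⌋ · ∏_{j≠i} C(n_j + a_j, n_j) and τ_2 := ⌈h^0(Ω^1_{ℙ^{n_i}}(a_i+1))/n_i⌉ · ∏_{j≠i} C(n_j + a_j, n_j). If s ≤ τ_1 or s ≥ τ_2, then the multiplication map μ : H^0(π_i^*(O_{ℙ^{n_i}}(1))) ⊗ H^0(I_S(a_1,…,a_k)) → H^0(I_S((a_1,…,a_k) + ε_i)) has maximal rank, i.e., it is injective or surjective. -/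

import Mathlib

/-!
Core framework: a concrete algebraic model of the multiprojective space
`X = ℙ^{n 0} × ⋯ × ℙ^{n (k-1)}` over a field `K`, via its multihomogeneous
coordinate ring `R = K[x_{ij}]`.
-/

open MvPolynomial Module
open scoped TensorProduct

namespace MultiProjPaper

variable (K : Type) [Field K] (k : ℕ) (n : Fin k → ℕ)

/-- Index type of the variables `x_{ij}`, `i = 1, …, k`, `0 ≤ j ≤ n i`. -/
abbrev MPIdx := Σ i : Fin k, Fin (n i + 1)

/-- The multihomogeneous coordinate ring `R = K[x_{ij}]` of the multiprojective space. -/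
abbrev MPR := MvPolynomial (MPIdx k n) K

/-- The weight of the variable `x_{ij}` is the multiindex `ε_i`. -/
def mpWeight : MPIdx k n → (Fin k → ℕ) := fun x => Pi.single x.1 1

/-- The space of multihomogeneous polynomials of multidegree `a`, i.e. `H^0(X, O_X(a))`. -/
noncomputable def mcomp (a : Fin k → ℕ) : Submodule K (MPR K k n) :=
  weightedHomogeneousSubmodule K (mpWeight k n) a

/-- A (representative of a) point of `X`: a tuple of nonzero vectors. -/
structure MPPoint where
  v : ∀ i : Fin k, Fin (n i + 1) → K
  nz : ∀ i, v i ≠ 0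

/-- Evaluation of a polynomial at (a representative of) a point. -/
noncomputable def MPPoint.ev (P : MPPoint K k n) (f : MPR K k n) : K :=
  MvPolynomial.eval (fun x : MPIdx k n => P.v x.1 x.2) f

/-- Evaluation at a scaling (by `lam i` on the `i`-th group of variables) of a point. -/
noncomputable def coneEval (lam : Fin k → K) (P : MPPoint K k n) (f : MPR K k n) : K :=
  MvPolynomial.eval (fun x : MPIdx k n => lam x.1 * P.v x.1 x.2) f

/-- The (multihomogeneous, saturated) vanishing ideal of a set of points of `X`:
all polynomials vanishing on the affine multicone over the set. -/
noncomputable def vanIdeal (S : Set (MPPoint K k n)) : Ideal (MPR K k n) where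
  carrier := {f | ∀ P ∈ S, ∀ lam : Fin k → K, coneEval K k n lam P f = 0}
  add_mem' := by
    intro f g hf hg P hP lam
    simp only [coneEval, map_add] at *
    rw [hf P hP lam, hg P hP lam, add_zero]
  zero_mem' := by intro P hP lam; simp [coneEval]
  smul_mem' := by
    intro c f hf P hP lam
    simp only [coneEval, smul_eq_mul, map_mul] at *
    rw [hf P hP lam, mul_zero]

/-- `H^0(X, 𝓘(a))` for the sheaf of ideals associated to a multihomogeneous ideal `I`:
the multidegree-`a` component of `I`. -/
noncomputable def secI (I : Ideal (MPR K k n)) (a : Fin k → ℕ) : Submodule K (MPR K k n) :=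
  mcomp K k n a ⊓ (Submodule.restrictScalars K I)

/-- `h^0(X, 𝓘(a))`. -/
noncomputable def h0I (I : Ideal (MPR K k n)) (a : Fin k → ℕ) : ℕ :=
  finrank K ↥(secI K k n I a)

/-- A zero-dimensional closed subscheme `Z ⊂ X`, modeled by its saturated multihomogeneous
ideal `I`, together with its degree (= length) `deg`: the multigraded Hilbert function of
`R/I` is eventually constant, equal to `deg`. -/
structure ZeroDimClosed where
  I : Ideal (MPR K k n)
  homog : ∀ f ∈ I, ∀ a : Fin k → ℕ, weightedHomogeneousComponent (mpWeight k n) a f ∈ I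
  saturated : ∀ f : MPR K k n,
    (∀ g : ∀ i : Fin k, Fin (n i + 1), (∏ i : Fin k, X (⟨i, g i⟩ : MPIdx k n)) * f ∈ I) → f ∈ I
  deg : ℕ
  hilb : ∃ d₀ : ℕ, ∀ a : Fin k → ℕ, (∀ i, d₀ ≤ a i) →
    finrank K ↥(secI K k n I a) + deg = finrank K ↥(mcomp K k n a)

/-- `h^0(X, 𝓘_Z(a))` for a zero-dimensional closed subscheme `Z`. -/
noncomputable def h0Z (Z : ZeroDimClosed K k n) (a : Fin k → ℕ) : ℕ := h0I K k n Z.I a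

/-- `h^1(X, 𝓘_Z(a))` for a zero-dimensional closed subscheme `Z` and `a ∈ ℕ^k`:
from the exact sequence `0 → 𝓘_Z(a) → O_X(a) → O_Z(a) → 0` and `h^1(O_X(a)) = 0`,
`h^1(𝓘_Z(a)) = deg Z - (h^0(O_X(a)) - h^0(𝓘_Z(a)))`. -/
noncomputable def h1Z (Z : ZeroDimClosed K k n) (a : Fin k → ℕ) : ℤ :=
  (Z.deg : ℤ) + (h0Z K k n Z a : ℤ) - (finrank K ↥(mcomp K k n a) : ℤ)

/-- "A general tuple of `s` points of `X` satisfies `P`": there is a nonzero polynomial `F`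
in the coordinates of the representative vectors of the `s` points (i.e. a nonempty Zariski
open subset of `X^s`) such that every tuple of points where `F` does not vanish satisfies `P`. -/
def GenericPts (s : ℕ) (P : (Fin s → MPPoint K k n) → Prop) : Prop :=
  ∃ F : MvPolynomial (Fin s × MPIdx k n) K, F ≠ 0 ∧
    ∀ T : Fin s → MPPoint K k n,
      MvPolynomial.eval (fun q : Fin s × MPIdx k n => (T q.1).v q.2.1 q.2.2) F ≠ 0 → P T

/-- "A general tuple of `d` vectors of the `K`-vector space `V` satisfies `P`":
there is a nonzero polynomial in the coordinates (w.r.t. a fixed basis) of the `d` vectors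
such that every tuple where it does not vanish satisfies `P`. -/
def GenericVecs (V : Type) [AddCommGroup V] [Module K V] (d : ℕ)
    (P : (Fin d → V) → Prop) : Prop :=
  ∃ F : MvPolynomial (Fin d × (Basis.ofVectorSpaceIndex K V)) K, F ≠ 0 ∧
    ∀ w : Fin d → V,
      MvPolynomial.eval
        (fun q : Fin d × (Basis.ofVectorSpaceIndex K V) =>
          (Basis.ofVectorSpace K V).repr (w q.1) q.2) F ≠ 0 → P w

/-- Multiplication `H^0(O_X(c)) ⊗ H^0(𝓘(a)) → H^0(𝓘(a + c))` as a bilinear map. -/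
noncomputable def mulSec (I : Ideal (MPR K k n)) (c a : Fin k → ℕ) :
    ↥(mcomp K k n c) →ₗ[K] ↥(secI K k n I a) →ₗ[K] ↥(secI K k n I (a + c)) :=
  LinearMap.mk₂ K
    (fun f g => ⟨(f : MPR K k n) * (g : MPR K k n), by
      constructor
      · have hf : IsWeightedHomogeneous (mpWeight k n) (f : MPR K k n) c := f.2
        have hg : IsWeightedHomogeneous (mpWeight k n) (g : MPR K k n) a := g.2.1
        have := hf.mul hg
        rw [add_comm c a] at this
        exact this
      · exact Ideal.mul_mem_left _ _ g.2.2⟩)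
    (fun f f' g => by apply Subtype.ext; simp [add_mul])
    (fun c' f g => by apply Subtype.ext; simp [smul_eq_mul]; try ring)
    (fun f g g' => by apply Subtype.ext; simp [mul_add])
    (fun c' f g => by apply Subtype.ext; simp [smul_eq_mul]; try ring)

/-- The multiplication map `μ : H^0(O_X(c)) ⊗ H^0(𝓘(a)) → H^0(𝓘(a+c))`. -/
noncomputable def mulMap (I : Ideal (MPR K k n)) (c a : Fin k → ℕ) :
    (↥(mcomp K k n c) ⊗[K] ↥(secI K k n I a)) →ₗ[K] ↥(secI K k n I (a + c)) :=
  TensorProduct.lift (mulSec K k n I c a)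

end MultiProjPaper

namespace MultiProjPaper

/-- Type wrapper for the underlying type of a submodule. -/
def SubT {K M : Type} [Field K] [AddCommGroup M] [Module K M] (p : Submodule K M) : Type := ↥p

noncomputable instance {K M : Type} [Field K] [AddCommGroup M] [Module K M]
    (p : Submodule K M) : AddCommGroup (SubT p) := inferInstanceAs (AddCommGroup ↥p)

noncomputable instance {K M : Type} [Field K] [AddCommGroup M] [Module K M]
    (p : Submodule K M) : Module K (SubT p) := inferInstanceAs (Module K ↥p)

/-- The underlying vector of an element of `SubT p`. -/
def SubT.val {K M : Type} [Field K] [AddCommGroup M] [Module K M] {p : Submodule K M}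
    (x : SubT p) : M := x.1

/-- The Euler map `(f_0, …, f_n) ↦ ∑ x_j f_j`. -/
noncomputable def eulerMap (K : Type) [Field K] (nn : ℕ) :
    (Fin (nn + 1) → MvPolynomial (Fin (nn + 1)) K) →ₗ[K] MvPolynomial (Fin (nn + 1)) K where
  toFun w := ∑ j, X j * w j
  map_add' a b := by simp [mul_add, Finset.sum_add_distrib]
  map_smul' c a := by simp [Finset.smul_sum, mul_smul_comm]

/-- `H^0(ℙ^n, Ω^1_{ℙ^n}(t))`, via the Euler sequence
`0 → Ω^1_{ℙ^n}(t) → O(t-1)^{n+1} → O(t) → 0`: tuples `(f_0, …, f_n)` of homogeneous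
forms of degree `t-1` with `∑ x_j f_j = 0`. -/
noncomputable def omegaSec (K : Type) [Field K] (nn t : ℕ) :
    Submodule K (Fin (nn + 1) → MvPolynomial (Fin (nn + 1)) K) :=
  (Submodule.pi Set.univ (fun _ => homogeneousSubmodule (Fin (nn + 1)) K (t - 1))) ⊓
    LinearMap.ker (eulerMap K nn)

/-- `h^0(ℙ^n, Ω^1_{ℙ^n}(t))`. -/
noncomputable def h0Omega (K : Type) [Field K] (nn t : ℕ) : ℕ :=
  finrank K (SubT (omegaSec K nn t))

/-- A (representative of a) point of `ℙ^n`: a nonzero coordinate vector. -/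
structure PtPn (K : Type) [Field K] (nn : ℕ) where
  P : Fin (nn + 1) → K
  hP : P ≠ 0

/-- "A general tuple of `s` points of `ℙ^n` satisfies `Φ`": there is a nonzero polynomial
`F` in the coordinates of the representatives of the `s` points (i.e. a nonempty Zariski
open subset of `(ℙ^n)^s`) such that every tuple of points where `F` does not vanish
satisfies `Φ`. -/
def GenericPtsPn (K : Type) [Field K] (nn s : ℕ) (Φ : (Fin s → PtPn K nn) → Prop) : Prop :=
  ∃ F : MvPolynomial (Fin s × Fin (nn + 1)) K, F ≠ 0 ∧
    ∀ T : Fin s → PtPn K nn,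
      MvPolynomial.eval (fun q => (T q.1).P q.2) F ≠ 0 → Φ T

/-- Evaluation of a section of `Ω^1_{ℙ^n}(t)` at a point of `ℙ^n` (with values in the
fiber `K^{n+1}` of the ambient `O(t-1)^{⊕(n+1)}` from the Euler sequence, in which
`Ω^1_{ℙ^n}(t)` is a subbundle). -/
noncomputable def evOmPt (K : Type) [Field K] (nn : ℕ) (pt : PtPn K nn) (t : ℕ) :
    SubT (omegaSec K nn t) →ₗ[K] (Fin (nn + 1) → K) where
  toFun w := fun j => eval pt.P (w.val j)
  map_add' a b := by
    funext j
    show eval pt.P ((a.val + b.val) j) = eval pt.P (a.val j) + eval pt.P (b.val j)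
    simp
  map_smul' c a := by
    funext j
    show eval pt.P ((c • a.val) j) = c * eval pt.P (a.val j)
    simp

/-- `H^0(ℙ^n, 𝓘_S ⊗ Ω^1_{ℙ^n}(t))`: sections of `Ω^1_{ℙ^n}(t)` vanishing at all the
points of `S`. -/
noncomputable def secOmPts (K : Type) [Field K] (nn : ℕ) {s : ℕ} (T : Fin s → PtPn K nn)
    (t : ℕ) : Submodule K (SubT (omegaSec K nn t)) :=
  ⨅ j : Fin s, LinearMap.ker (evOmPt K nn (T j) t)

/-- `h^0(ℙ^n, 𝓘_S ⊗ Ω^1_{ℙ^n}(t))`. -/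
noncomputable def h0OmS (K : Type) [Field K] (nn : ℕ) {s : ℕ} (T : Fin s → PtPn K nn)
    (t : ℕ) : ℕ :=
  finrank K (SubT (secOmPts K nn T t))

/-- `h^1(ℙ^n, 𝓘_S ⊗ Ω^1_{ℙ^n}(t))` (for `t ≥ 1`), computed from the restriction exact
sequence for the rank-`n` bundle `Ω^1_{ℙ^n}(t)` (which has `h^1 = 0` for `t ≠ 0`):
`h^1(𝓘_S ⊗ Ω^1(t)) = n·#S - (h^0(Ω^1(t)) - h^0(𝓘_S ⊗ Ω^1(t)))`. -/
noncomputable def h1OmS (K : Type) [Field K] (nn : ℕ) {s : ℕ} (T : Fin s → PtPn K nn)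
    (t : ℕ) : ℤ :=
  (nn : ℤ) * s - (h0Omega K nn t : ℤ) + (h0OmS K nn T t : ℤ)

end MultiProjPaper

namespace MultiProjPaper

section LinearAlgebra

variable {K : Type} [Field K]

/-- The rank of a linear map depending polynomially on parameters is lower semicontinuous. -/
theorem exists_poly_finrank_range_le {σ ι V : Type} [Finite ι] [AddCommGroup V] [Module K V]
    (Φ : V →ₗ[K] (ι → MvPolynomial σ K)) (ev : (σ → K) → V →ₗ[K] (ι → K))
    (hev : ∀ x e q, ev x e q = eval x (Φ e q)) (x₀ : σ → K) :
    ∃ F : MvPolynomial σ K, eval x₀ F ≠ 0 ∧ ∀ x, eval x F ≠ 0 →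
      finrank K (LinearMap.range (ev x₀)) ≤ finrank K (LinearMap.range (ev x)) := by
  classical
  have := Fintype.ofFinite ι
  set r := finrank K (LinearMap.range (ev x₀)) with hr
  let b := finBasis K (LinearMap.range (ev x₀))
  choose e he using fun m => (b m).2
  obtain ⟨p, hp⟩ := (LinearMap.range (ev x₀)).subtype.exists_leftInverse_of_injective
    (Submodule.ker_subtype _)
  let L : (ι → K) →ₗ[K] (Fin r → K) := b.equivFun.toLinearMap ∘ₗ p
  have hL : ∀ v m, L v m = ∑ q, v q * L (Pi.single q 1) m := by
    intro v m
    conv_lhs => rw [pi_eq_sum_univ' v, map_sum]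
    simp [Finset.sum_apply]
  let M : Matrix (Fin r) (Fin r) (MvPolynomial σ K) :=
    fun m m' => ∑ q, Φ (e m) q * C (L (Pi.single q 1) m')
  have hM : ∀ x, (eval x).mapMatrix M = fun m m' => L (ev x (e m)) m' := by
    intro x
    ext m m'
    rw [hL]
    change eval x (M m m') = _
    simp [M, hev]
  refine ⟨M.det, ?_, fun x hx => ?_⟩
  · rw [RingHom.map_det, hM]
    have : (fun m m' => L (ev x₀ (e m)) m') = (1 : Matrix (Fin r) (Fin r) K) := by
      ext m m'
      have h1 : p (b m) = b m := LinearMap.congr_fun hp (b m)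
      simp [L, he, h1, Matrix.one_apply]
    rw [this]
    simp
  · rw [RingHom.map_det, hM] at hx
    have hli : LinearIndependent K (fun m => L (ev x (e m))) :=
      Matrix.linearIndependent_rows_of_det_ne_zero hx
    have hli' : LinearIndependent K (fun m => (ev x).rangeRestrict (e m)) :=
      LinearIndependent.of_comp (L ∘ₗ (LinearMap.range (ev x)).subtype) hli
    simpa using hli'.fintype_card_le_finrank

/-- A finite-dimensional space with a separating family of functionals has as many points of
the family as its dimension that admit interpolation and detect zero. -/
theorem exists_interpolation_points {Ω V : Type} [AddCommGroup V] [Module K V] [Module.Finite K V]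
    (ev : Ω → V →ₗ[K] K) (hsep : ∀ v, (∀ ω, ev ω v = 0) → v = 0) {N : ℕ}
    (hN : finrank K V = N) :
    ∃ y : Fin N → Ω, (∀ v, (∀ l, ev (y l) v = 0) → v = 0) ∧
      ∃ h : Fin N → V, ∀ l m, ev (y l) (h m) = if l = m then 1 else 0 := by
  have hspan : Submodule.span K (Set.range ev) = ⊤ := by
    refine Submodule.span_eq_top_of_ne_zero fun v hv => ?_
    by_contra! h
    exact hv (hsep v fun ω => h _ ⟨ω, rfl⟩)
  obtain ⟨f, hf, hfs, -⟩ := Submodule.exists_fun_fin_finrank_span_eq K (Set.range ev)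
  have hcard : finrank K (Submodule.span K (Set.range ev)) = N := by
    rw [hspan, finrank_top, Subspace.dual_finrank_eq, hN]
  replace hfs := hfs.trans hspan
  generalize finrank K (Submodule.span K (Set.range ev)) = N' at f hcard
  subst hcard
  choose y hy using hf
  have hdet : ∀ v, (∀ l, ev (y l) v = 0) → v = 0 := by
    intro v hv
    have : ∀ φ : Dual K V, φ v = 0 := by
      intro φ
      have hφ : φ ∈ Submodule.span K (Set.range f) := hfs ▸ Submodule.mem_top
      induction hφ using Submodule.span_induction with
      | mem φ h => obtain ⟨l, rfl⟩ := h; rw [← hy]; exact hv l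
      | zero => rfl
      | add a b _ _ ha hb => simp [ha, hb]
      | smul c a _ ha => simp [ha]
    exact (Module.forall_dual_apply_eq_zero_iff K v).1 this
  refine ⟨y, hdet, ?_⟩
  let E : V →ₗ[K] (Fin N' → K) := LinearMap.pi fun l => ev (y l)
  have hinj : Function.Injective E := by
    rw [← LinearMap.ker_eq_bot, eq_bot_iff]
    exact fun v hv => hdet v fun l => congrFun hv l
  have hsurj := (LinearMap.injective_iff_surjective_of_finrank_eq_finrank (by simp [hN])).1 hinj
  choose h hh using fun m => hsurj (Pi.single m 1)
  refine ⟨h, fun l m => ?_⟩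
  have := congrFun (hh m) l
  simpa [E, Pi.single_apply] using this

/-- The pairing of a tuple of vectors with a tuple of nonzero coordinate vectors. -/
noncomputable def pairing {s m : ℕ} (P : Fin s → Fin m → K) :
    (Fin s × Fin m → K) →ₗ[K] (Fin s → K) where
  toFun v l := ∑ j, P l j * v (l, j)
  map_add' a b := by funext l; simp [mul_add, Finset.sum_add_distrib]
  map_smul' c a := by funext l; simp [Finset.mul_sum, mul_left_comm]

theorem finrank_ker_pairing {s m : ℕ} (P : Fin s → Fin (m + 1) → K) (hP : ∀ l, P l ≠ 0) :
    finrank K (LinearMap.ker (pairing P)) = m * s := by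
  have hsurj : LinearMap.range (pairing P) = ⊤ := by
    rw [LinearMap.range_eq_top]
    intro c
    choose j hj using fun l => Function.ne_iff.1 (hP l)
    refine ⟨fun q => if q.2 = j q.1 then c q.1 / P q.1 q.2 else 0, ?_⟩
    funext l
    have := hj l
    simp only [Pi.zero_apply] at this
    simp [pairing, mul_div_cancel₀, this]
  have h := LinearMap.finrank_range_add_finrank_ker (pairing P)
  rw [hsurj, finrank_top] at h
  simp at h
  nlinarith

end LinearAlgebra

section Polynomials

variable {K : Type} [Field K]

theorem isWeightedHomogeneous_aeval {σ τ M N : Type} [AddCommMonoid M]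
    [AddCommMonoid N] {w : σ → M} {w' : τ → N} (φ : M →+ N) {g : σ → MvPolynomial τ K}
    (hg : ∀ x, IsWeightedHomogeneous w' (g x) (φ (w x))) {f : MvPolynomial σ K} {m : M}
    (hf : IsWeightedHomogeneous w f m) : IsWeightedHomogeneous w' (aeval g f) (φ m) := by
  induction hf using IsWeightedHomogeneous.induction_on with
  | zero => simpa using isWeightedHomogeneous_zero K w' _
  | add p q _ _ hp hq => simpa using hp.add hq
  | monomial d r hr =>
    rw [aeval_monomial, algebraMap_eq]
    refine IsWeightedHomogeneous.C_mul ?_ r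
    rw [← hr, Finsupp.weight_apply, Finsupp.sum, map_sum, Finsupp.prod]
    simp_rw [map_nsmul]
    exact IsWeightedHomogeneous.prod _ _ _ fun x _ => (hg x).pow _

/-- A nonzero polynomial over an infinite field does not vanish at some vector with no zero
coordinate. -/
theorem exists_eval_ne_zero_of_ne_zero [Infinite K] {σ : Type} [Fintype σ]
    {F : MvPolynomial σ K} (hF : F ≠ 0) : ∃ x : σ → K, (∀ q, x q ≠ 0) ∧ eval x F ≠ 0 := by
  by_contra! h
  have h0 : F * ∏ q, X q = 0 := by
    refine MvPolynomial.funext fun x => ?_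
    by_cases hx : ∀ q, x q ≠ 0
    · simp [h x hx]
    · push Not at hx
      obtain ⟨q, hq⟩ := hx
      simp [Finset.prod_eq_zero (Finset.mem_univ q) hq]
  rcases mul_eq_zero.1 h0 with h | h
  · exact hF h
  · exact absurd h (Finset.prod_ne_zero_iff.2 fun q _ => X_ne_zero q)

end Polynomials

section Multihomogeneous

variable {K : Type} [Field K] {k : ℕ} {n : Fin k → ℕ}

theorem weight_mpWeight_apply (d : MPIdx k n →₀ ℕ) (j : Fin k) :
    Finsupp.weight (mpWeight k n) d j = ∑ m, d ⟨j, m⟩ := by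
  rw [Finsupp.weight_apply, Finsupp.sum_fintype _ _ (by simp), Finset.sum_apply,
    Fintype.sum_sigma, Finset.sum_eq_single j]
  · simp [mpWeight]
  · intro j' _ hj'
    simp [mpWeight, hj'.symm]
  · simp

theorem mem_mcomp {a : Fin k → ℕ} {f : MPR K k n} :
    f ∈ mcomp K k n a ↔ IsWeightedHomogeneous (mpWeight k n) f a := Iff.rfl

/-- Exponents of multidegree `a` are families of exponents of degree `a j`. -/
noncomputable def exponentEquiv (n a : Fin k → ℕ) :
    {d : MPIdx k n →₀ ℕ // Finsupp.weight (mpWeight k n) d = a} ≃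
      ∀ j, {P : Fin (n j + 1) → ℕ // ∑ m, P m = a j} where
  toFun d j := ⟨fun m => d.1 ⟨j, m⟩, by rw [← weight_mpWeight_apply, d.2]⟩
  invFun P := ⟨Finsupp.equivFunOnFinite.symm fun x => (P x.1).1 x.2, by
    funext j
    rw [weight_mpWeight_apply]
    exact (P j).2⟩
  left_inv d := by ext; rfl
  right_inv P := rfl

noncomputable instance (a : Fin k → ℕ) :
    Fintype {d : MPIdx k n →₀ ℕ // Finsupp.weight (mpWeight k n) d = a} :=
  Fintype.ofEquiv (∀ j, Sym (Fin (n j + 1)) (a j))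
    ((Equiv.piCongrRight fun j => Sym.equivNatSumOfFintype (Fin (n j + 1)) (a j)).trans
      (exponentEquiv n a).symm)

theorem mcomp_eq_span (a : Fin k → ℕ) :
    mcomp K k n a = Submodule.span K (Set.range
      fun d : {d : MPIdx k n →₀ ℕ // Finsupp.weight (mpWeight k n) d = a} =>
        basisMonomials (MPIdx k n) K d.1) := by
  refine le_antisymm (fun f hf => ?_) (Submodule.span_le.2 ?_)
  · rw [mem_mcomp] at hf
    induction hf using IsWeightedHomogeneous.induction_on with
    | zero => exact zero_mem _
    | add p q _ _ hp hq => exact add_mem hp hq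
    | monomial d r hr =>
      have : monomial d r = r • basisMonomials (MPIdx k n) K d := by
        simp [smul_monomial]
      rw [this]
      exact Submodule.smul_mem _ _ (Submodule.subset_span ⟨⟨d, hr⟩, rfl⟩)
  · rintro _ ⟨d, rfl⟩
    simpa [mem_mcomp] using isWeightedHomogeneous_monomial _ _ _ d.2

instance (a : Fin k → ℕ) : Module.Finite K (mcomp K k n a) := by
  rw [mcomp_eq_span]
  exact Module.Finite.span_of_finite K (Set.finite_range _)

theorem finrank_mcomp (a : Fin k → ℕ) :
    finrank K (mcomp K k n a) = ∏ j, (n j + a j).choose (n j) := by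
  rw [mcomp_eq_span]
  refine (finrank_span_eq_card
    ((basisMonomials (MPIdx k n) K).linearIndependent.comp _ Subtype.val_injective)).trans ?_
  rw [Fintype.card_congr ((Equiv.piCongrRight fun j =>
      Sym.equivNatSumOfFintype (Fin (n j + 1)) (a j)).trans (exponentEquiv n a).symm).symm,
    Fintype.card_pi]
  refine Finset.prod_congr rfl fun j _ => ?_
  rw [Sym.card_sym_eq_choose, Fintype.card_fin, Nat.choose_symm_add]
  congr 1
  omega

/-- Replacing the coordinates of the `i`-th factor. -/
def replaceCoords {L : Type} (i : Fin k) (p : Fin (n i + 1) → L) (y : ∀ j, Fin (n j + 1) → L) :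
    MPIdx k n → L :=
  fun x => Function.update y i p x.1 x.2

/-- Specialization of all variables outside the `i`-th group at `y`. -/
noncomputable def specializeAway (i : Fin k) (y : ∀ j, Fin (n j + 1) → K) :
    MPR K k n →ₐ[K] MvPolynomial (Fin (n i + 1)) K :=
  aeval (replaceCoords i (fun m => X m) fun j m => C (y j m))

/-- Specialization of the `i`-th group of variables at `p`. -/
noncomputable def specializeAt (i : Fin k) (p : Fin (n i + 1) → K) : MPR K k n →ₐ[K] MPR K k n :=
  aeval (replaceCoords i (fun m => C (p m)) fun j m => X ⟨j, m⟩)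

theorem replaceCoords_comp {L L' : Type} (φ : L → L') (i : Fin k) (p : Fin (n i + 1) → L)
    (y : ∀ j, Fin (n j + 1) → L) (x : MPIdx k n) :
    φ (replaceCoords i p y x) = replaceCoords i (fun m => φ (p m)) (fun j m => φ (y j m)) x := by
  obtain ⟨j, m⟩ := x
  by_cases h : j = i
  · subst h; simp [replaceCoords]
  · simp [replaceCoords, h]

theorem eval_specializeAway (i : Fin k) (p : Fin (n i + 1) → K) (y : ∀ j, Fin (n j + 1) → K)
    (f : MPR K k n) : eval p (specializeAway i y f) = eval (replaceCoords i p y) f := by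
  rw [specializeAway, ← coe_aeval_eq_eval, ← coe_aeval_eq_eval, RingHom.coe_coe, RingHom.coe_coe,
    ← AlgHom.comp_apply, comp_aeval]
  congr 2
  funext x
  rw [replaceCoords_comp (aeval p)]
  simp

theorem eval_specializeAt (i : Fin k) (p : Fin (n i + 1) → K) (y : ∀ j, Fin (n j + 1) → K)
    (f : MPR K k n) :
    eval (fun x => y x.1 x.2) (specializeAt i p f) = eval (replaceCoords i p y) f := by
  rw [specializeAt, ← coe_aeval_eq_eval, ← coe_aeval_eq_eval, RingHom.coe_coe, RingHom.coe_coe,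
    ← AlgHom.comp_apply, comp_aeval]
  congr 2
  funext x
  rw [replaceCoords_comp (aeval fun x : MPIdx k n => y x.1 x.2)]
  simp

theorem specializeAway_mem {a : Fin k → ℕ} (i : Fin k) (y : ∀ j, Fin (n j + 1) → K)
    {f : MPR K k n} (hf : f ∈ mcomp K k n a) :
    specializeAway i y f ∈ homogeneousSubmodule (Fin (n i + 1)) K (a i) := by
  refine isWeightedHomogeneous_aeval (Pi.evalAddMonoidHom (fun _ => ℕ) i) ?_ hf
  rintro ⟨j, m⟩
  by_cases h : j = i
  · subst h
    simpa [replaceCoords, mpWeight] using isWeightedHomogeneous_X K (1 : Fin (n j + 1) → ℕ) m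
  · simpa [replaceCoords, mpWeight, h, Ne.symm h] using isWeightedHomogeneous_C 1 (y j m)

theorem specializeAt_mem {a : Fin k → ℕ} (i : Fin k) (p : Fin (n i + 1) → K)
    {f : MPR K k n} (hf : f ∈ mcomp K k n a) :
    specializeAt i p f ∈ mcomp K k n (Function.update a i 0) := by
  let φ : (Fin k → ℕ) →+ (Fin k → ℕ) :=
    { toFun := fun b => Function.update b i 0
      map_zero' := by simp
      map_add' := fun b c => by
        funext j
        by_cases h : j = i
        · subst h; simp
        · simp [h] }
  refine isWeightedHomogeneous_aeval φ ?_ hf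
  rintro ⟨j, m⟩
  by_cases h : j = i
  · subst h
    simpa [φ, replaceCoords, mpWeight, Pi.single] using
      isWeightedHomogeneous_C (mpWeight k n) (p m)
  · have : φ (mpWeight k n ⟨j, m⟩) = mpWeight k n ⟨j, m⟩ := by
      simp [φ, mpWeight, Ne.symm h]
    rw [this]
    simpa [replaceCoords, h] using isWeightedHomogeneous_X K (mpWeight k n) ⟨j, m⟩

theorem rename_mul_mem {a : Fin k → ℕ} (i : Fin k) {f : MvPolynomial (Fin (n i + 1)) K}
    (hf : f ∈ homogeneousSubmodule (Fin (n i + 1)) K (a i)) {h : MPR K k n}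
    (hh : h ∈ mcomp K k n (Function.update a i 0)) :
    rename (fun m => (⟨i, m⟩ : MPIdx k n)) f * h ∈ mcomp K k n a := by
  have hf' : IsWeightedHomogeneous (mpWeight k n)
      (rename (fun m => (⟨i, m⟩ : MPIdx k n)) f) (Pi.single i (a i)) := by
    rw [rename_eq_aeval]
    refine isWeightedHomogeneous_aeval (w := 1) (AddMonoidHom.single (fun _ => ℕ) i) (fun m => ?_) hf
    exact isWeightedHomogeneous_X K (mpWeight k n) ⟨i, m⟩
  have := hf'.mul hh
  have ha : Pi.single i (a i) + Function.update a i 0 = a := by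
    funext j
    by_cases h : j = i
    · subst h; simp
    · simp [h]
  rwa [ha] at this

theorem coneEval_eq (lam : Fin k → K) (P : MPPoint K k n) {a : Fin k → ℕ} {f : MPR K k n}
    (hf : f ∈ mcomp K k n a) :
    coneEval K k n lam P f = (∏ j, lam j ^ a j) * P.ev K k n f := by
  rw [mem_mcomp] at hf
  induction hf using IsWeightedHomogeneous.induction_on with
  | zero => simp [coneEval, MPPoint.ev]
  | add p q _ _ hp hq => simp only [coneEval, MPPoint.ev, map_add, mul_add] at *; rw [hp, hq]
  | monomial d r hr =>
    simp only [coneEval, MPPoint.ev, eval_monomial, mul_pow]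
    rw [Finsupp.prod_fintype _ _ (by simp), Finsupp.prod_fintype _ _ (by simp),
      Finset.prod_mul_distrib, Fintype.prod_sigma]
    simp_rw [Finset.prod_pow_eq_pow_sum, ← weight_mpWeight_apply, hr]
    ring

theorem mem_secI_vanIdeal {s : ℕ} (T : Fin s → MPPoint K k n) {a : Fin k → ℕ} {f : MPR K k n} :
    f ∈ secI K k n (vanIdeal K k n (Set.range T)) a ↔
      f ∈ mcomp K k n a ∧ ∀ l, (T l).ev K k n f = 0 := by
  refine and_congr_right fun hf => ⟨fun h l => ?_, fun h => ?_⟩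
  · have := h (T l) ⟨l, rfl⟩ 1
    simpa [coneEval_eq 1 (T l) hf] using this
  · rintro _ ⟨l, rfl⟩ lam
    rw [coneEval_eq lam (T l) hf, h l, mul_zero]

theorem exists_eq_sum_X_mul (i : Fin k) {a : Fin k → ℕ} {f : MPR K k n}
    (hf : f ∈ mcomp K k n (a + Pi.single i 1)) :
    ∃ g : Fin (n i + 1) → MPR K k n, (∀ j, g j ∈ mcomp K k n a) ∧
      ∑ j, X (⟨i, j⟩ : MPIdx k n) * g j = f := by
  rw [mem_mcomp] at hf
  induction hf using IsWeightedHomogeneous.induction_on with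
  | zero => exact ⟨0, fun j => zero_mem _, by simp⟩
  | add p q _ _ hp hq =>
    obtain ⟨g, hg, rfl⟩ := hp
    obtain ⟨g', hg', rfl⟩ := hq
    exact ⟨g + g', fun j => add_mem (hg j) (hg' j), by simp [mul_add, Finset.sum_add_distrib]⟩
  | monomial d r hr =>
    obtain ⟨m, hm⟩ : ∃ m, d ⟨i, m⟩ ≠ 0 := by
      by_contra! h
      have := weight_mpWeight_apply d i
      simp [hr, h] at this
    have hd : Finsupp.single (⟨i, m⟩ : MPIdx k n) 1 + (d - Finsupp.single ⟨i, m⟩ 1) = d :=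
      add_tsub_cancel_of_le (by simpa [Nat.one_le_iff_ne_zero] using hm)
    refine ⟨Pi.single m (monomial (d - Finsupp.single ⟨i, m⟩ 1) r), fun j => ?_, ?_⟩
    · by_cases h : j = m
      · subst h
        rw [Pi.single_eq_same]
        refine isWeightedHomogeneous_monomial _ _ _ ?_
        have hw := congrArg (Finsupp.weight (mpWeight k n)) hd
        rw [map_add, hr, Finsupp.weight_single, one_smul, add_comm a] at hw
        exact add_left_cancel hw
      · simp [h]
    · rw [Finset.sum_eq_single m (fun j _ h => by simp [h]) (by simp), Pi.single_eq_same, X,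
        monomial_mul, one_mul, hd]

theorem exists_eq_C_of_mem_mcomp_zero {f : MPR K k n} (hf : f ∈ mcomp K k n 0) :
    ∃ c, f = C c := by
  rw [mem_mcomp] at hf
  induction hf using IsWeightedHomogeneous.induction_on with
  | zero => exact ⟨0, by simp⟩
  | add p q _ _ hp hq =>
    obtain ⟨c, rfl⟩ := hp
    obtain ⟨c', rfl⟩ := hq
    exact ⟨c + c', by simp⟩
  | monomial d r hr =>
    have hd : d = 0 := by
      ext ⟨j, m⟩
      have := weight_mpWeight_apply d j
      rw [hr] at this
      simpa using Finset.sum_eq_zero_iff.1 this.symm m (Finset.mem_univ m)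
    exact ⟨r, by simp [hd]⟩

theorem mcomp_single_eq_span (i : Fin k) :
    mcomp K k n (Pi.single i 1) =
      Submodule.span K (Set.range fun j => X (⟨i, j⟩ : MPIdx k n)) := by
  refine le_antisymm (fun f hf => ?_) (Submodule.span_le.2 ?_)
  · obtain ⟨g, hg, rfl⟩ := exists_eq_sum_X_mul (a := 0) i (by simpa using hf)
    refine sum_mem fun j _ => ?_
    obtain ⟨c, hc⟩ := exists_eq_C_of_mem_mcomp_zero (hg j)
    rw [hc, mul_comm, ← smul_eq_C_mul]
    exact Submodule.smul_mem _ _ (Submodule.subset_span ⟨j, rfl⟩)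
  · rintro _ ⟨j, rfl⟩
    exact isWeightedHomogeneous_X K (mpWeight k n) ⟨i, j⟩

end Multihomogeneous

section CotangentSections

variable {K : Type} [Field K]

instance (nn t : ℕ) : Module.Finite K (SubT (omegaSec K nn t)) := by
  have (_ : Fin (nn + 1)) : Module.Finite K (homogeneousSubmodule (Fin (nn + 1)) K (t - 1)) :=
    Module.Finite.iff_fg.2 (homogeneousSubmodule_fg _ _ _)
  let f : omegaSec K nn t →ₗ[K]
      (Fin (nn + 1) → homogeneousSubmodule (Fin (nn + 1)) K (t - 1)) :=
    { toFun := fun w j => ⟨w.1 j, w.2.1 j trivial⟩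
      map_add' := fun _ _ => rfl
      map_smul' := fun _ _ => rfl }
  exact Module.Finite.of_injective f fun v w h =>
    Subtype.ext (funext fun j => congrArg Subtype.val (congrFun h j))

theorem mem_omegaSec {nn t : ℕ} {w : Fin (nn + 1) → MvPolynomial (Fin (nn + 1)) K} :
    w ∈ omegaSec K nn t ↔
      (∀ j, w j ∈ homogeneousSubmodule (Fin (nn + 1)) K (t - 1)) ∧ ∑ j, X j * w j = 0 := by
  simp [omegaSec, eulerMap]

/-- Evaluation of sections of the twisted cotangent bundle at a tuple of points. -/
noncomputable def evalOmega {nn c : ℕ} (A : Fin c → PtPn K nn) (t : ℕ) :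
    SubT (omegaSec K nn t) →ₗ[K] (Fin c × Fin (nn + 1) → K) :=
  LinearMap.pi fun q => LinearMap.proj q.2 ∘ₗ evOmPt K nn (A q.1) t

theorem ker_evalOmega {nn c : ℕ} (A : Fin c → PtPn K nn) (t : ℕ) :
    LinearMap.ker (evalOmega A t) = secOmPts K nn A t := by
  ext w
  simp [evalOmega, secOmPts, funext_iff]

theorem range_evalOmega_le {nn c : ℕ} (A : Fin c → PtPn K nn) (t : ℕ) :
    LinearMap.range (evalOmega A t) ≤ LinearMap.ker (pairing fun l => (A l).P) := by
  rintro _ ⟨w, rfl⟩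
  rw [LinearMap.mem_ker]
  funext l
  have h := congrArg (eval (A l).P) (mem_omegaSec.1 w.2).2
  simpa [pairing, evalOmega, evOmPt, SubT.val] using h

theorem finrank_range_evalOmega_add {nn c : ℕ} (A : Fin c → PtPn K nn) (t : ℕ) :
    finrank K (LinearMap.range (evalOmega A t)) + h0OmS K nn A t = h0Omega K nn t := by
  have h := LinearMap.finrank_range_add_finrank_ker (evalOmega A t)
  rwa [ker_evalOmega] at h

theorem exists_eval_eq_of_maximal_rank {nn c t : ℕ} {A : Fin c → PtPn K nn}
    (hA : h0OmS K nn A t = 0 ∨ h1OmS K nn A t = 0) (hc : nn * c ≤ h0Omega K nn t)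
    {v : Fin c × Fin (nn + 1) → K} (hv : pairing (fun l => (A l).P) v = 0) :
    ∃ w ∈ omegaSec K nn t, ∀ l j, eval (A l).P (w j) = v (l, j) := by
  have hle := range_evalOmega_le A t
  have hker := finrank_ker_pairing (fun l => (A l).P) fun l => (A l).hP
  have hadd := finrank_range_evalOmega_add A t
  have heq := Submodule.eq_of_le_of_finrank_le hle <| by
    rw [hker]
    rcases hA with hA | hA
    · omega
    · rw [h1OmS] at hA
      zify at hadd ⊢
      linarith
  obtain ⟨w, hw⟩ : v ∈ LinearMap.range (evalOmega A t) := heq ▸ hv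
  exact ⟨w.1, w.2, fun l j => congrFun hw (l, j)⟩

theorem eq_zero_of_maximal_rank {nn c t : ℕ} {A : Fin c → PtPn K nn}
    (hA : h0OmS K nn A t = 0 ∨ h1OmS K nn A t = 0) (hc : h0Omega K nn t ≤ nn * c)
    {w : Fin (nn + 1) → MvPolynomial (Fin (nn + 1)) K} (hw : w ∈ omegaSec K nn t)
    (hv : ∀ l j, eval (A l).P (w j) = 0) : w = 0 := by
  have h0 : h0OmS K nn A t = 0 := by
    rcases hA with hA | hA
    · exact hA
    · rw [h1OmS] at hA
      zify at hc ⊢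
      linarith [(Int.natCast_nonneg (h0OmS K nn A t))]
  have hker : LinearMap.ker (evalOmega A t) = ⊥ := by
    rw [ker_evalOmega]
    exact Submodule.finrank_eq_zero.1 h0
  let w' : SubT (omegaSec K nn t) := ⟨w, hw⟩
  have hw' : evalOmega A t w' = 0 := funext fun q => hv q.1 q.2
  exact congrArg SubT.val (LinearMap.ker_eq_bot'.1 hker w' hw')

theorem GenericPtsPn.exists [Infinite K] {nn s : ℕ} {Φ : (Fin s → PtPn K nn) → Prop}
    (h : GenericPtsPn K nn s Φ) : ∃ A, Φ A := by
  obtain ⟨F, hF, hΦ⟩ := h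
  obtain ⟨x, hx, hxF⟩ := exists_eval_ne_zero_of_ne_zero hF
  exact ⟨fun l => ⟨fun m => x (l, m), fun h => hx (l, 0) (congrFun h 0)⟩, hΦ _ hxF⟩

end CotangentSections

section Multiplication

variable {K : Type} [Field K] {k : ℕ} {n : Fin k → ℕ}

/-- Tuples `(g_j)` of multidegree `a` with `∑ x_{ij} g_j = 0`: the global sections of the
pullback of `Ω^1(a i + 1)` from the `i`-th factor, twisted in the other factors by `a`. -/
noncomputable def eulerKer (K : Type) [Field K] {k : ℕ} (n : Fin k → ℕ) (i : Fin k)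
    (a : Fin k → ℕ) : Submodule K (Fin (n i + 1) → MPR K k n) :=
  Submodule.pi Set.univ (fun _ => mcomp K k n a) ⊓
    LinearMap.ker (Fintype.linearCombination (MPR K k n)
      (fun j => (X ⟨i, j⟩ : MPR K k n)) |>.restrictScalars K)

theorem mem_eulerKer {i : Fin k} {a : Fin k → ℕ} {g : Fin (n i + 1) → MPR K k n} :
    g ∈ eulerKer K n i a ↔ (∀ j, g j ∈ mcomp K k n a) ∧
      ∑ j, X (⟨i, j⟩ : MPIdx k n) * g j = 0 := by
  simp [eulerKer, Fintype.linearCombination_apply, mul_comm]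

instance (i : Fin k) (a : Fin k → ℕ) : Module.Finite K (eulerKer K n i a) := by
  let f : eulerKer K n i a →ₗ[K] (Fin (n i + 1) → mcomp K k n a) :=
    { toFun := fun w j => ⟨w.1 j, w.2.1 j trivial⟩
      map_add' := fun _ _ => rfl
      map_smul' := fun _ _ => rfl }
  exact Module.Finite.of_injective f fun v w h =>
    Subtype.ext (funext fun j => congrArg Subtype.val (congrFun h j))

/-- Evaluation of tuples of polynomials at a tuple of coordinate vectors. -/
noncomputable def evalEulerKer (i : Fin k) (a : Fin k → ℕ) {s : ℕ}
    (x : Fin s × MPIdx k n → K) :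
    eulerKer K n i a →ₗ[K] (Fin s × Fin (n i + 1) → K) where
  toFun g q := eval (fun y => x (q.1, y)) (g.1 q.2)
  map_add' g h := by funext q; simp
  map_smul' c g := by funext q; simp

/-- The coordinates of a tuple of points. -/
def coords {s : ℕ} (T : Fin s → MPPoint K k n) : Fin s × MPIdx k n → K :=
  fun q => (T q.1).v q.2.1 q.2.2

theorem range_evalEulerKer_le (i : Fin k) (a : Fin k → ℕ) {s : ℕ} (T : Fin s → MPPoint K k n) :
    LinearMap.range (evalEulerKer i a (coords T)) ≤
      LinearMap.ker (pairing fun l => (T l).v i) := by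
  rintro _ ⟨g, rfl⟩
  rw [LinearMap.mem_ker]
  funext l
  have h := congrArg ((T l).ev K k n) (mem_eulerKer.1 g.2).2
  simpa [pairing, evalEulerKer, coords, MPPoint.ev] using h

theorem exists_poly_finrank_range_evalEulerKer_le (i : Fin k) (a : Fin k → ℕ) {s : ℕ}
    (x₀ : Fin s × MPIdx k n → K) :
    ∃ F : MvPolynomial (Fin s × MPIdx k n) K, F ≠ 0 ∧ ∀ x, eval x F ≠ 0 →
      finrank K (LinearMap.range (evalEulerKer i a x₀)) ≤
        finrank K (LinearMap.range (evalEulerKer i a x)) := by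
  let Φ : eulerKer K n i a →ₗ[K] (Fin s × Fin (n i + 1) → MvPolynomial (Fin s × MPIdx k n) K) :=
    { toFun := fun g q => rename (fun y => (q.1, y)) (g.1 q.2)
      map_add' := fun g h => by funext q; simp
      map_smul' := fun c g => by funext q; simp }
  obtain ⟨F, hF, h⟩ := exists_poly_finrank_range_le Φ (evalEulerKer i a)
    (fun x e q => by simp [Φ, evalEulerKer, eval_rename, Function.comp_def]) x₀
  exact ⟨F, fun h0 => hF (by simp [h0]), h⟩

theorem mulMap_surjective (i : Fin k) (a : Fin k → ℕ) {s : ℕ} (T : Fin s → MPPoint K k n)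
    (h : LinearMap.ker (pairing fun l => (T l).v i) ≤
      LinearMap.range (evalEulerKer i a (coords T))) :
    Function.Surjective
      (mulMap K k n (vanIdeal K k n (Set.range T)) (Pi.single i 1) a) := by
  rintro ⟨f, hf⟩
  obtain ⟨hfa, hfT⟩ := (mem_secI_vanIdeal T).1 hf
  obtain ⟨g, hg, rfl⟩ := exists_eq_sum_X_mul i hfa
  have hv : (fun q : Fin s × Fin (n i + 1) => (T q.1).ev K k n (g q.2)) ∈
      LinearMap.ker (pairing fun l => (T l).v i) := by
    rw [LinearMap.mem_ker]
    funext l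
    simpa [pairing, MPPoint.ev] using hfT l
  obtain ⟨e, he⟩ := h hv
  obtain ⟨hea, he0⟩ := mem_eulerKer.1 e.2
  have hsec : ∀ j, g j - e.1 j ∈ secI K k n (vanIdeal K k n (Set.range T)) a := by
    refine fun j => (mem_secI_vanIdeal T).2 ⟨sub_mem (hg j) (hea j), fun l => ?_⟩
    have := congrFun he (l, j)
    simp only [evalEulerKer, coords, LinearMap.coe_mk, AddHom.coe_mk, MPPoint.ev] at this
    simp [MPPoint.ev, ← this]
  refine ⟨∑ j, (⟨X ⟨i, j⟩, isWeightedHomogeneous_X K (mpWeight k n) ⟨i, j⟩⟩ :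
    mcomp K k n (Pi.single i 1)) ⊗ₜ[K] ⟨g j - e.1 j, hsec j⟩, Subtype.ext ?_⟩
  simp [mulMap, mulSec, mul_sub, he0]

theorem mulMap_injective (i : Fin k) (a : Fin k → ℕ) {s : ℕ} (T : Fin s → MPPoint K k n)
    (h : LinearMap.ker (evalEulerKer i a (coords T)) = ⊥) :
    Function.Injective
      (mulMap K k n (vanIdeal K k n (Set.range T)) (Pi.single i 1) a) := by
  let S := secI K k n (vanIdeal K k n (Set.range T)) a
  let x : Fin (n i + 1) → mcomp K k n (Pi.single i 1) :=
    fun j => ⟨X ⟨i, j⟩, isWeightedHomogeneous_X K (mpWeight k n) ⟨i, j⟩⟩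
  have hx : ∀ f : mcomp K k n (Pi.single i 1), ∃ c : Fin (n i + 1) → K, f = ∑ j, c j • x j := by
    rintro ⟨f, hf⟩
    have hf' := hf
    rw [mcomp_single_eq_span, Submodule.mem_span_range_iff_exists_fun] at hf'
    obtain ⟨c, hc⟩ := hf'
    exact ⟨c, Subtype.ext (by simp [x, ← hc])⟩
  have hsum : ∀ z : mcomp K k n (Pi.single i 1) ⊗[K] S, ∃ g : Fin (n i + 1) → S,
      z = ∑ j, x j ⊗ₜ[K] g j := by
    intro z
    induction z using TensorProduct.induction_on with
    | zero => exact ⟨0, by simp⟩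
    | add y z hy hz =>
      obtain ⟨g, rfl⟩ := hy
      obtain ⟨g', rfl⟩ := hz
      exact ⟨g + g', by simp [TensorProduct.tmul_add, Finset.sum_add_distrib]⟩
    | tmul f g =>
      obtain ⟨c, rfl⟩ := hx f
      exact ⟨fun j => c j • g, by simp [TensorProduct.sum_tmul, TensorProduct.smul_tmul]⟩
  rw [injective_iff_map_eq_zero]
  intro z hz
  obtain ⟨g, rfl⟩ := hsum z
  have hg : (fun j => (g j : MPR K k n)) ∈ eulerKer K n i a := by
    refine mem_eulerKer.2 ⟨fun j => (g j).2.1, ?_⟩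
    have := congrArg Subtype.val hz
    simpa [mulMap, mulSec, x] using this
  have hmem : (⟨_, hg⟩ : eulerKer K n i a) ∈ LinearMap.ker (evalEulerKer i a (coords T)) := by
    rw [LinearMap.mem_ker]
    funext q
    exact ((mem_secI_vanIdeal T).1 (g q.2).2).2 q.1
  rw [h, Submodule.mem_bot] at hmem
  refine Finset.sum_eq_zero fun j _ => ?_
  have : g j = 0 := Subtype.ext (congrFun (congrArg Subtype.val hmem) j)
  rw [this, TensorProduct.tmul_zero]

end Multiplication

section SpecialPosition

variable {K : Type} [Field K] {k : ℕ} {n : Fin k → ℕ}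

theorem finrank_mcomp_update_zero (i : Fin k) (a : Fin k → ℕ) :
    finrank K (mcomp K k n (Function.update a i 0)) =
      ∏ j ∈ Finset.univ.erase i, (n j + a j).choose (n j) := by
  rw [finrank_mcomp, ← Finset.mul_prod_erase _ _ (Finset.mem_univ i)]
  rw [Function.update_self, add_zero, Nat.choose_self, one_mul]
  refine Finset.prod_congr rfl fun j hj => ?_
  rw [Function.update_of_ne (Finset.ne_of_mem_erase hj)]

theorem eq_zero_of_forall_ev_eq_zero [Infinite K] {f : MPR K k n}
    (hf : ∀ P : MPPoint K k n, P.ev K k n f = 0) : f = 0 := by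
  by_contra h
  obtain ⟨x, hx, hxf⟩ := exists_eval_ne_zero_of_ne_zero h
  exact hxf (hf ⟨fun j m => x ⟨j, m⟩, fun j hj => hx ⟨j, 0⟩ (congrFun hj 0)⟩)

/-- The point of the product with `i`-th component `p` and the other components those of `y`. -/
def MPPoint.replace (y : MPPoint K k n) (i : Fin k) (p : PtPn K (n i)) : MPPoint K k n where
  v := Function.update y.v i p.P
  nz j := by
    by_cases h : j = i
    · subst h; simpa using p.hP
    · simpa [h] using y.nz j

theorem MPPoint.ev_replace (y : MPPoint K k n) (i : Fin k) (p : PtPn K (n i)) (f : MPR K k n) :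
    (y.replace i p).ev K k n f = eval (replaceCoords i p.P y.v) f := rfl

/-- Points whose evaluations form a basis of the dual of the space of forms of multidegree `a`
in the variables outside the `i`-th group. -/
theorem exists_points_away [Infinite K] (i : Fin k) (a : Fin k → ℕ) {N : ℕ}
    (hN : ∏ j ∈ Finset.univ.erase i, (n j + a j).choose (n j) = N) :
    ∃ y : Fin N → MPPoint K k n,
      (∀ f ∈ mcomp K k n (Function.update a i 0), (∀ l, (y l).ev K k n f = 0) → f = 0) ∧
      ∃ h : Fin N → MPR K k n, (∀ m, h m ∈ mcomp K k n (Function.update a i 0)) ∧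
        ∀ l m, (y l).ev K k n (h m) = if l = m then 1 else 0 := by
  let ev : MPPoint K k n → mcomp K k n (Function.update a i 0) →ₗ[K] K := fun P =>
    (aeval fun x : MPIdx k n => P.v x.1 x.2).toLinearMap ∘ₗ Submodule.subtype _
  have hev : ∀ P f, ev P f = P.ev K k n f := fun P f => by simp [ev, MPPoint.ev]
  obtain ⟨y, hy, h, hh⟩ := exists_interpolation_points ev (fun v hv =>
    Subtype.ext (eq_zero_of_forall_ev_eq_zero fun P => (hev P v).symm.trans (hv P)))
    ((finrank_mcomp_update_zero i a).trans hN)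
  refine ⟨y, fun f hf hl => ?_, fun m => h m, fun m => (h m).2, fun l m => ?_⟩
  · exact congrArg Subtype.val (hy ⟨f, hf⟩ fun l => (hev _ _).trans (hl l))
  · rw [← hev, hh]

theorem eulerKer_eq_zero_of_eval_grid [Infinite K] {i : Fin k} {a : Fin k → ℕ} {c N : ℕ}
    {A : Fin c → PtPn K (n i)} (hA : ∀ w ∈ omegaSec K (n i) (a i + 1),
      (∀ l j, eval (A l).P (w j) = 0) → w = 0)
    {y : Fin N → MPPoint K k n}
    (hy : ∀ f ∈ mcomp K k n (Function.update a i 0), (∀ l, (y l).ev K k n f = 0) → f = 0)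
    {g : Fin (n i + 1) → MPR K k n} (hg : g ∈ eulerKer K n i a)
    (hv : ∀ α β j, ((y β).replace i (A α)).ev K k n (g j) = 0) : g = 0 := by
  obtain ⟨hga, hg0⟩ := mem_eulerKer.1 hg
  have h0 : ∀ β, (fun j => specializeAway i (y β).v (g j)) = 0 := by
    intro β
    refine hA _ (mem_omegaSec.2 ⟨fun j => specializeAway_mem i _ (hga j), ?_⟩) fun α j => ?_
    · have := congrArg (specializeAway i (y β).v) hg0
      simpa [specializeAway, replaceCoords] using this
    · rw [eval_specializeAway]
      exact hv α β j
  funext j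
  refine MvPolynomial.funext fun x => ?_
  have h1 : specializeAt i (fun m => x ⟨i, m⟩) (g j) = 0 := by
    refine hy _ (specializeAt_mem i _ (hga j)) fun β => ?_
    rw [MPPoint.ev, eval_specializeAt, ← eval_specializeAway]
    simpa using congrArg (eval fun m => x ⟨i, m⟩) (congrFun (h0 β) j)
  have h2 := eval_specializeAt i (fun m => x ⟨i, m⟩) (fun j m => x ⟨j, m⟩) (g j)
  have h3 : replaceCoords i (fun m => x ⟨i, m⟩) (fun j m => x ⟨j, m⟩) = x := by
    funext ⟨j, m⟩
    by_cases h : j = i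
    · subst h; simp [replaceCoords]
    · simp [replaceCoords, h]
  rw [h1, h3] at h2
  simpa using h2.symm

theorem eval_replaceCoords_of_mem {i : Fin k} {b : Fin k → ℕ} {f : MPR K k n}
    (hf : f ∈ mcomp K k n b) (hb : b i = 0) (p : Fin (n i + 1) → K)
    (y : ∀ j, Fin (n j + 1) → K) :
    eval (replaceCoords i p y) f = eval (fun x : MPIdx k n => y x.1 x.2) f := by
  rw [mem_mcomp] at hf
  induction hf using IsWeightedHomogeneous.induction_on with
  | zero => simp
  | add p q _ _ hp hq => simp only [map_add, hp, hq]
  | monomial d r hr =>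
    rw [eval_monomial, eval_monomial]
    congr 1
    refine Finsupp.prod_congr ?_
    rintro ⟨j, m⟩ hd
    by_cases h : j = i
    · subst h
      have hw := weight_mpWeight_apply d j
      rw [hr, hb] at hw
      exact absurd (Finset.sum_eq_zero_iff.1 hw.symm m (Finset.mem_univ m))
        (Finsupp.mem_support_iff.1 hd)
    · simp [replaceCoords, h]

theorem exists_eulerKer_eval_grid {i : Fin k} {a : Fin k → ℕ} {c N : ℕ}
    {A : Fin c → PtPn K (n i)} (hA : ∀ v : Fin c × Fin (n i + 1) → K,
      pairing (fun l => (A l).P) v = 0 →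
        ∃ w ∈ omegaSec K (n i) (a i + 1), ∀ l j, eval (A l).P (w j) = v (l, j))
    {y : Fin N → MPPoint K k n} {h : Fin N → MPR K k n}
    (hh : ∀ m, h m ∈ mcomp K k n (Function.update a i 0))
    (hyh : ∀ l m, (y l).ev K k n (h m) = if l = m then 1 else 0)
    (v : Fin N → Fin c × Fin (n i + 1) → K) (hv : ∀ β, pairing (fun l => (A l).P) (v β) = 0) :
    ∃ g ∈ eulerKer K n i a, ∀ α β j,
      ((y β).replace i (A α)).ev K k n (g j) = v β (α, j) := by
  choose w hw hwv using fun β => hA (v β) (hv β)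
  refine ⟨fun j => ∑ β, rename (fun m => (⟨i, m⟩ : MPIdx k n)) (w β j) * h β,
    mem_eulerKer.2 ⟨fun j => sum_mem fun β _ =>
      rename_mul_mem i ((mem_omegaSec.1 (hw β)).1 j) (hh β), ?_⟩, fun α β j => ?_⟩
  · simp_rw [Finset.mul_sum]
    rw [Finset.sum_comm]
    refine Finset.sum_eq_zero fun β _ => ?_
    have := congrArg (rename fun m => (⟨i, m⟩ : MPIdx k n)) (mem_omegaSec.1 (hw β)).2
    simp only [map_sum, map_mul, rename_X, map_zero] at this
    simp_rw [← mul_assoc, ← Finset.sum_mul, this, zero_mul]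
  · have hev : ∀ β', eval (replaceCoords i (A α).P (y β).v) (h β') =
        if β = β' then 1 else 0 := by
      intro β'
      rw [← hyh, MPPoint.ev, eval_replaceCoords_of_mem (hh β') (by simp)]
    rw [MPPoint.ev_replace, map_sum]
    simp only [map_mul, hev, eval_rename]
    simp only [mul_ite, mul_one, mul_zero, Finset.sum_ite_eq, Finset.mem_univ, if_true]
    rw [← hwv]
    congr 2
    funext m
    simp [replaceCoords]

theorem genericPts_surjective_of_exists (i : Fin k) (a : Fin k → ℕ) {s : ℕ}
    (T₀ : Fin s → MPPoint K k n)
    (h : LinearMap.ker (pairing fun l => (T₀ l).v i) ≤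
      LinearMap.range (evalEulerKer i a (coords T₀))) :
    GenericPts K k n s fun T => Function.Surjective
      (mulMap K k n (vanIdeal K k n (Set.range T)) (Pi.single i 1) a) := by
  obtain ⟨F, hF, hrank⟩ := exists_poly_finrank_range_evalEulerKer_le i a (coords T₀)
  refine ⟨F, hF, fun T hT => mulMap_surjective i a T ?_⟩
  refine (Submodule.eq_of_le_of_finrank_le (range_evalEulerKer_le i a T) ?_).ge
  have hle := (Submodule.finrank_mono h).trans (hrank (coords T) hT)
  rwa [finrank_ker_pairing _ fun l => (T₀ l).nz i,
    ← finrank_ker_pairing (fun l => (T l).v i) fun l => (T l).nz i] at hle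

theorem genericPts_injective_of_exists (i : Fin k) (a : Fin k → ℕ) {s : ℕ}
    (T₀ : Fin s → MPPoint K k n) (h : LinearMap.ker (evalEulerKer i a (coords T₀)) = ⊥) :
    GenericPts K k n s fun T => Function.Injective
      (mulMap K k n (vanIdeal K k n (Set.range T)) (Pi.single i 1) a) := by
  obtain ⟨F, hF, hrank⟩ := exists_poly_finrank_range_evalEulerKer_le i a (coords T₀)
  refine ⟨F, hF, fun T hT => mulMap_injective i a T ?_⟩
  have h₀ := LinearMap.finrank_range_add_finrank_ker (evalEulerKer i a (coords T₀))
  have h₁ := LinearMap.finrank_range_add_finrank_ker (evalEulerKer i a (coords T))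
  have hle := hrank (coords T) hT
  rw [h, finrank_bot] at h₀
  exact Submodule.finrank_eq_zero.1 (by omega)

theorem genericPts_surjective_of_le_mul [Infinite K] (i : Fin k) (a : Fin k → ℕ) {s c : ℕ}
    (hA : GenericPtsPn K (n i) c fun A =>
      h0OmS K (n i) A (a i + 1) = 0 ∨ h1OmS K (n i) A (a i + 1) = 0)
    (hc : n i * c ≤ h0Omega K (n i) (a i + 1))
    (hs : s ≤ c * ∏ j ∈ Finset.univ.erase i, (n j + a j).choose (n j)) :
    GenericPts K k n s fun T => Function.Surjective
      (mulMap K k n (vanIdeal K k n (Set.range T)) (Pi.single i 1) a) := by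
  obtain ⟨A, hA⟩ := hA.exists
  generalize hN : ∏ j ∈ Finset.univ.erase i, (n j + a j).choose (n j) = N at hs
  obtain ⟨y, -, h, hh, hyh⟩ := exists_points_away (K := K) i a hN
  let σ := fun l : Fin s => finProdFinEquiv.symm (Fin.castLE hs l)
  refine genericPts_surjective_of_exists i a (fun l => (y (σ l).2).replace i (A (σ l).1)) ?_
  intro v hv
  have hv' : ∀ l, ∑ j, (A (σ l).1).P j * v (l, j) = 0 := fun l => by
    simpa [pairing, MPPoint.replace] using congrFun (LinearMap.mem_ker.1 hv) l
  let v' := fun (β : Fin N) (q : Fin c × Fin (n i + 1)) =>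
    if hl : (finProdFinEquiv (q.1, β)).1 < s then v (⟨_, hl⟩, q.2) else 0
  have hσ : ∀ α β (hl : (finProdFinEquiv (α, β)).1 < s), σ ⟨_, hl⟩ = (α, β) := fun α β hl =>
    (Equiv.symm_apply_eq _).2 (Fin.ext rfl)
  obtain ⟨g, hg, hgv⟩ := exists_eulerKer_eval_grid
    (fun v hv => exists_eval_eq_of_maximal_rank hA hc hv) hh hyh v' fun β => by
      funext α
      by_cases hl : (finProdFinEquiv (α, β)).1 < s
      · have := hv' ⟨_, hl⟩
        rw [hσ] at this
        simpa [pairing, v', hl, -finProdFinEquiv_apply_val] using this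
      · simp [pairing, v', hl, -finProdFinEquiv_apply_val]
  refine ⟨⟨g, hg⟩, funext fun ⟨l, j⟩ => (hgv (σ l).1 (σ l).2 j).trans ?_⟩
  simp [v', σ, Nat.mod_add_div]

theorem genericPts_injective_of_mul_le [Infinite K] (i : Fin k) (a : Fin k → ℕ) {s c : ℕ}
    (hA : GenericPtsPn K (n i) c fun A =>
      h0OmS K (n i) A (a i + 1) = 0 ∨ h1OmS K (n i) A (a i + 1) = 0)
    (hc : h0Omega K (n i) (a i + 1) ≤ n i * c)
    (hs : c * ∏ j ∈ Finset.univ.erase i, (n j + a j).choose (n j) ≤ s) :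
    GenericPts K k n s fun T => Function.Injective
      (mulMap K k n (vanIdeal K k n (Set.range T)) (Pi.single i 1) a) := by
  obtain ⟨A, hA⟩ := hA.exists
  generalize hN : ∏ j ∈ Finset.univ.erase i, (n j + a j).choose (n j) = N at hs
  obtain ⟨y, hy, -⟩ := exists_points_away (K := K) i a hN
  let P₀ : MPPoint K k n := ⟨fun _ _ => 1, fun _ h => one_ne_zero (congrFun h 0)⟩
  let grid := fun q : Fin c × Fin N => (y q.2).replace i (A q.1)
  let T₀ := fun l : Fin s =>
    if hl : l.1 < c * N then grid (finProdFinEquiv.symm ⟨l.1, hl⟩) else P₀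
  refine genericPts_injective_of_exists i a T₀ (LinearMap.ker_eq_bot'.2 fun g hg => ?_)
  refine Subtype.ext (eulerKer_eq_zero_of_eval_grid
    (fun w hw hv => eq_zero_of_maximal_rank hA hc hw hv) hy g.2 fun α β j => ?_)
  have hlt := (finProdFinEquiv (α, β)).2
  have hT : T₀ ⟨(finProdFinEquiv (α, β)).1, hlt.trans_le hs⟩ = grid (α, β) :=
    (dif_pos hlt).trans (congrArg grid (Equiv.symm_apply_apply _ _))
  have := congrFun hg (⟨(finProdFinEquiv (α, β)).1, hlt.trans_le hs⟩, j)
  simp only [evalEulerKer, coords, LinearMap.coe_mk, AddHom.coe_mk, hT] at this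
  exact this

end SpecialPosition

/-- Proposition `ee2`.
Let `X = ℙ^{n_1} × ⋯ × ℙ^{n_k}`. Fix `i`, `s ∈ ℕ` and `a ∈ ℕ^k` with `a_i ≥ t(n_i) - 1`,
where `t(n_i)` is an integer such that for all `t ≥ t(n_i)` and all cardinalities, a
general finite subset `A ⊂ ℙ^{n_i}` satisfies `h^0(𝓘_A ⊗ Ω^1_{ℙ^{n_i}}(t)) = 0` or
`h^1(𝓘_A ⊗ Ω^1_{ℙ^{n_i}}(t)) = 0`. Let `S ⊂ X` be a general subset of cardinality `s`.
Set `τ₁ := ⌊h^0(Ω^1_{ℙ^{n_i}}(a_i+1))/n_i⌋ · ∏_{j≠i} C(n_j + a_j, n_j)` and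
`τ₂ := ⌈h^0(Ω^1_{ℙ^{n_i}}(a_i+1))/n_i⌉ · ∏_{j≠i} C(n_j + a_j, n_j)`. If `s ≤ τ₁` or
`s ≥ τ₂`, then the multiplication map
`μ : H^0(π_i^*(O_{ℙ^{n_i}}(1))) ⊗ H^0(𝓘_S(a)) → H^0(𝓘_S(a + ε_i))` has maximal rank,
i.e. it is injective or surjective. -/
theorem statement14 (K : Type) [Field K] [IsAlgClosed K] [CharZero K]
    (k : ℕ) (n : Fin k → ℕ) (hn : ∀ i, 1 ≤ n i)
    (i : Fin k) (s : ℕ) (a : Fin k → ℕ)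
    (tni : ℕ)
    (htni : ∀ t : ℕ, tni ≤ t → ∀ c : ℕ,
      GenericPtsPn K (n i) c (fun A => h0OmS K (n i) A t = 0 ∨ h1OmS K (n i) A t = 0))
    (hai : tni - 1 ≤ a i)
    (hτ : s ≤ (h0Omega K (n i) (a i + 1) / n i) *
            ∏ j ∈ Finset.univ.erase i, Nat.choose (n j + a j) (n j)
        ∨ ((h0Omega K (n i) (a i + 1) + n i - 1) / n i) *
            ∏ j ∈ Finset.univ.erase i, Nat.choose (n j + a j) (n j) ≤ s) :
    GenericPts K k n s (fun T =>
      Function.Injective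
        ⇑(mulMap K k n (vanIdeal K k n (Set.range T)) (Pi.single i 1) a) ∨
      Function.Surjective
        ⇑(mulMap K k n (vanIdeal K k n (Set.range T)) (Pi.single i 1) a)) := by
  have hgen := htni (a i + 1) (by omega)
  rcases hτ with hs | hs
  · obtain ⟨F, hF, h⟩ := genericPts_surjective_of_le_mul i a (hgen _) (Nat.mul_div_le _ _) hs
    exact ⟨F, hF, fun T hT => Or.inr (h T hT)⟩
  · have hc : h0Omega K (n i) (a i + 1) ≤
        n i * ((h0Omega K (n i) (a i + 1) + n i - 1) / n i) := by
      have h1 := Nat.div_add_mod (h0Omega K (n i) (a i + 1) + n i - 1) (n i)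
      have h2 := Nat.mod_lt (h0Omega K (n i) (a i + 1) + n i - 1) (hn i)
      have := hn i
      omega
    obtain ⟨F, hF, h⟩ := genericPts_injective_of_mul_le i a (hgen _) hc hs
    exact ⟨F, hF, fun T hT => Or.inl (h T hT)⟩

end MultiProjPaper
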